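/- arXiv:2002.00779 — 2 statements merged into one kernel-verified Lean document; each statement's English description precedes it below -/
import Mathlib

section
/- For jointly Gaussian scalar random variables X and Y with correlation coefficient ρ (with |ρ| < 1), Wyner's common information equals C(X;Y) = (1/2)·log( (1 + |ρ|) / (1 − |ρ|) ). -/
open MeasureTheory ProbabilityTheory Real Classical
open scoped ENNReal NNReal

noncomputable section

/-- Kullback–Leibler divergence `D(μ‖ν) = ∫ log(dμ/dν) dμ`, with value `⊤` when `μ` is not
absolutely continuous w.r.t. `ν` or the log-likelihood ratio is not integrable. -/
noncomputable def klDivE {E : Type*} [MeasurableSpace E] (μ ν : Measure E) : EReal :=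
  if μ ≪ ν ∧ Integrable (llr μ ν) μ then ((∫ x, llr μ ν x ∂μ : ℝ) : EReal) else ⊤

/-- Mutual information of a pair with joint law `ρ`: the KL divergence between `ρ` and the
product of its marginals. -/
noncomputable def miE {E F : Type*} [MeasurableSpace E] [MeasurableSpace F]
    (ρ : Measure (E × F)) : EReal :=
  klDivE ρ ((ρ.map Prod.fst).prod (ρ.map Prod.snd))

end

/-- Gibbs' variational lower bound for the Kullback–Leibler divergence. -/
lemma integral_le_of_klDivE_eq {E : Type*} [MeasurableSpace E] {ν Q : Measure E}
    [IsProbabilityMeasure ν] [SigmaFinite Q] {g : E → ℝ} {c : ℝ}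
    (hg : Measurable g) (hgi : Integrable g ν)
    (hQ : ∫⁻ x, ENNReal.ofReal (exp (g x)) ∂Q ≤ 1) (hc : klDivE ν Q = c) :
    ∫ x, g x ∂ν ≤ c := by
  unfold klDivE at hc
  split_ifs at hc with h
  · obtain ⟨hac, hi⟩ := h
    rw [EReal.coe_eq_coe_iff] at hc
    rw [← hc]
    have hm : Measurable (fun x => ENNReal.ofReal (exp (g x - llr ν Q x))) := by
      have := measurable_llr ν Q
      fun_prop
    have h1 : ∫⁻ x, ENNReal.ofReal (exp (g x - llr ν Q x)) ∂ν ≤ 1 := by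
      rw [← lintegral_rnDeriv_mul hac hm.aemeasurable]
      refine le_trans (lintegral_mono_ae ?_) hQ
      filter_upwards [Measure.rnDeriv_lt_top ν Q] with x hx
      rcases eq_or_ne (ν.rnDeriv Q x) 0 with h0 | h0
      · simp [h0]
      · have hpos : 0 < (ν.rnDeriv Q x).toReal := ENNReal.toReal_pos h0 hx.ne
        rw [llr, exp_sub, exp_log hpos]
        conv_lhs => arg 1; rw [← ENNReal.ofReal_toReal hx.ne]
        rw [← ENNReal.ofReal_mul hpos.le, mul_div_cancel₀ _ hpos.ne']
    have hint : Integrable (fun x => exp (g x - llr ν Q x)) ν := by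
      refine ⟨by have := measurable_llr ν Q; fun_prop, ?_⟩
      rw [hasFiniteIntegral_iff_ofReal (ae_of_all _ fun x => (exp_pos _).le)]
      exact h1.trans_lt ENNReal.one_lt_top
    have h2 : ∫ x, exp (g x - llr ν Q x) ∂ν ≤ 1 := by
      rw [integral_eq_lintegral_of_nonneg_ae (ae_of_all _ fun x => (exp_pos _).le)
        hint.aestronglyMeasurable]
      exact ENNReal.toReal_le_of_le_ofReal zero_le_one (by simpa using h1)
    have h3 : ∫ x, (g x - llr ν Q x + 1) ∂ν ≤ ∫ x, exp (g x - llr ν Q x) ∂ν :=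
      integral_mono ((hgi.sub hi).add (integrable_const 1)) hint fun x => add_one_le_exp _
    have h4 : ∫ x, (g x - llr ν Q x + 1) ∂ν = ∫ x, g x ∂ν - ∫ x, llr ν Q x ∂ν + 1 := by
      have := integral_add (hgi.sub hi) (integrable_const (μ := ν) (1 : ℝ))
      simpa [integral_sub hgi hi] using this
    linarith
  · exact absurd hc (EReal.coe_ne_top c).symm

lemma klDivE_withDensity_exp {E : Type*} [MeasurableSpace E] {Q : Measure E}
    [SigmaFinite Q] {g : E → ℝ} (hg : Measurable g)
    (hgi : Integrable g (Q.withDensity fun x => ENNReal.ofReal (exp (g x)))) :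
    klDivE (Q.withDensity fun x => ENNReal.ofReal (exp (g x))) Q =
      ((∫ x, g x ∂(Q.withDensity fun x => ENNReal.ofReal (exp (g x))) : ℝ) : EReal) := by
  set ν := Q.withDensity fun x => ENNReal.ofReal (exp (g x)) with hν
  have hac : ν ≪ Q := withDensity_absolutelyContinuous _ _
  have hl : llr ν Q =ᵐ[ν] g := by
    refine hac.ae_le ?_
    filter_upwards [Measure.rnDeriv_withDensity Q
      (f := fun x => ENNReal.ofReal (exp (g x))) (by fun_prop)] with x hx
    rw [llr, hν, hx, ENNReal.toReal_ofReal (exp_pos _).le, log_exp]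
  rw [klDivE, if_pos ⟨hac, hgi.congr hl.symm⟩, integral_congr_ae hl]

lemma lintegral_gaussianReal_affine {h : ℝ → ℝ≥0∞} (hh : Measurable h) (c : ℝ) {d : ℝ}
    (hd : d ≠ 0) :
    ∫⁻ n, h (c + d * n) ∂gaussianReal 0 1 =
      ∫⁻ x, gaussianPDF c (d ^ 2).toNNReal x * h x := by
  have h1 : (gaussianReal 0 1).map (fun n => c + d * n) = gaussianReal c (d ^ 2).toNNReal := by
    have : (fun n => c + d * n) = (c + ·) ∘ (d * ·) := rfl
    rw [this, ← Measure.map_map (by fun_prop) (by fun_prop), gaussianReal_map_const_mul,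
      gaussianReal_map_const_add]
    congr 1
    · simp
    · ext; simp [sq_nonneg d]
  have hv : (d ^ 2).toNNReal ≠ 0 := by
    rw [ne_eq, Real.toNNReal_eq_zero, not_le]; positivity
  rw [← lintegral_map (f := h) (g := fun n => c + d * n) hh (by fun_prop), h1,
    gaussianReal_of_var_ne_zero _ hv, lintegral_withDensity_eq_lintegral_mul _ (by fun_prop) hh]
  rfl

lemma ext_of_integral_cexp {P P' : Measure (ℝ × ℝ)} [IsFiniteMeasure P] [IsFiniteMeasure P']
    (h : ∀ a b : ℝ, ∫ p, Complex.exp (((a * p.1 + b * p.2 : ℝ) : ℂ) * Complex.I) ∂P =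
      ∫ p, Complex.exp (((a * p.1 + b * p.2 : ℝ) : ℂ) * Complex.I) ∂P') : P = P' := by
  refine Measure.ext_of_charFunDual (funext fun L => ?_)
  have hL : ∀ p : ℝ × ℝ, L p = L (1, 0) * p.1 + L (0, 1) * p.2 := by
    intro p
    have : L (p.1 • ((1 : ℝ), (0 : ℝ)) + p.2 • ((0 : ℝ), (1 : ℝ))) = L p := by simp
    rw [← this, map_add, map_smul, map_smul, smul_eq_mul, smul_eq_mul, mul_comm, mul_comm p.2]
  rw [charFunDual_apply, charFunDual_apply]
  simpa only [← hL] using h (L (1, 0)) (L (0, 1))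

lemma integral_cexp_gaussianReal (t : ℝ) :
    ∫ n, Complex.exp (((t * n : ℝ) : ℂ) * Complex.I) ∂gaussianReal 0 1 =
      Complex.exp (-((t ^ 2 / 2 : ℝ) : ℂ)) := by
  have := charFun_gaussianReal (μ := 0) (v := 1) t
  rw [charFun_apply_real] at this
  push_cast
  rw [this]
  congr 1
  push_cast
  ring

lemma condExp_mul_ae_eq_of_condIndepFun {Ω : Type*} {m' mΩ : MeasurableSpace Ω}
    [StandardBorelSpace Ω] (hm : m' ≤ mΩ) {ν : Measure Ω} [IsProbabilityMeasure ν]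
    {f g : Ω → ℝ} (hf : Measurable f) (hg : Measurable g)
    (hfi : Integrable f ν) (hgi : Integrable g ν) (hfg : Integrable (fun ω => f ω * g ω) ν)
    (h : CondIndepFun m' hm f g ν) :
    ν[fun ω => f ω * g ω | m'] =ᵐ[ν] fun ω => (ν[f | m']) ω * (ν[g | m']) ω := by
  rw [condIndepFun_iff_map_prod_eq_prod_map_map hf hg] at h
  filter_upwards [ae_of_ae_trim hm h, condExp_ae_eq_integral_condExpKernel hm hfg,
    condExp_ae_eq_integral_condExpKernel hm hfi,
    condExp_ae_eq_integral_condExpKernel hm hgi] with ω h1 h2 h3 h4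
  rw [h2, h3, h4]
  refine IndepFun.integral_fun_mul_eq_mul_integral ?_ hf.aestronglyMeasurable
    hg.aestronglyMeasurable
  rw [indepFun_iff_map_prod_eq_prod_map_map hf.aemeasurable hg.aemeasurable]
  rw [Kernel.map_apply _ (by fun_prop), Kernel.prod_apply, Kernel.map_apply _ hf,
    Kernel.map_apply _ hg] at h1
  exact h1

/-- Functions of `(w, n₁)` and `(w, n₂)` are conditionally independent given `w`, when `w`, `n₁`
and `n₂` are independent. -/
lemma condIndepFun_map_prod {G : Measure ℝ} [IsProbabilityMeasure G]
    {f g : ℝ × ℝ → ℝ} (hf : Measurable f) (hg : Measurable g)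
    {ν : Measure ((ℝ × ℝ) × ℝ)} [IsProbabilityMeasure ν]
    (hν : ν = (G.prod (G.prod G)).map fun q => ((f (q.1, q.2.1), g (q.1, q.2.2)), q.1)) :
    CondIndepFun (MeasurableSpace.comap Prod.snd inferInstance)
      (MeasurableSpace.comap_le_iff_le_map.mpr measurable_snd.le_map)
      (fun p : (ℝ × ℝ) × ℝ => p.1.1) (fun p => p.1.2) ν := by
  let κ : (ℝ × ℝ → ℝ) → Kernel ℝ ℝ := fun h => (Kernel.id ×ₖ Kernel.const ℝ G).map h
  have hκ : ∀ {h : ℝ × ℝ → ℝ}, Measurable h → ∀ {φ : ℝ → ℝ≥0∞}, Measurable φ → ∀ w,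
      ∫⁻ x, φ x ∂κ h w = ∫⁻ n, φ (h (w, n)) ∂G := by
    intro h hh φ hφ w
    rw [Kernel.lintegral_map _ hh _ hφ, Kernel.lintegral_id_prod (by fun_prop)]
    simp
  have hsnd : ν.map Prod.snd = G := by
    rw [hν, Measure.map_map (by fun_prop) (by fun_prop)]
    exact Measure.fst_prod
  have mkf : IsMarkovKernel (κ f) := Kernel.IsMarkovKernel.map _ hf
  have mkg : IsMarkovKernel (κ g) := Kernel.IsMarkovKernel.map _ hg
  have hcf : condDistrib (fun p : (ℝ × ℝ) × ℝ => p.1.1) Prod.snd ν =ᵐ[ν.map Prod.snd] κ f := by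
    refine condDistrib_ae_eq_of_measure_eq_compProd _ (by fun_prop) ?_
    rw [hsnd]
    refine Measure.ext_of_lintegral _ fun φ hφ => ?_
    rw [lintegral_map hφ (by fun_prop), hν, lintegral_map (by fun_prop) (by fun_prop),
      lintegral_prod _ (by fun_prop), Measure.lintegral_compProd hφ]
    refine lintegral_congr fun w => ?_
    rw [hκ hf (by fun_prop), lintegral_prod _ (by fun_prop)]
    simp
  have hcg : condDistrib (fun p : (ℝ × ℝ) × ℝ => p.1.2) Prod.snd ν =ᵐ[ν.map Prod.snd] κ g := by
    refine condDistrib_ae_eq_of_measure_eq_compProd _ (by fun_prop) ?_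
    rw [hsnd]
    refine Measure.ext_of_lintegral _ fun φ hφ => ?_
    rw [lintegral_map hφ (by fun_prop), hν, lintegral_map (by fun_prop) (by fun_prop),
      lintegral_prod _ (by fun_prop), Measure.lintegral_compProd hφ]
    refine lintegral_congr fun w => ?_
    rw [hκ hg (by fun_prop), lintegral_prod _ (by fun_prop)]
    simp
  refine (condIndepFun_iff_map_prod_eq_prod_condDistrib_prod_condDistrib
    (by fun_prop) (by fun_prop) measurable_snd).mpr ?_
  rw [← Measure.compProd_eq_comp_prod, Measure.compProd_congr (κ := _) (η := κ f ×ₖ κ g)]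
  · rw [hsnd]
    refine Measure.ext_of_lintegral _ fun φ hφ => ?_
    rw [lintegral_map hφ (by fun_prop), hν, lintegral_map (by fun_prop) (by fun_prop),
      lintegral_prod _ (by fun_prop), Measure.lintegral_compProd hφ]
    refine lintegral_congr fun w => ?_
    rw [Kernel.lintegral_prod _ _ _ (by fun_prop), hκ hf, lintegral_prod _ (by fun_prop)]
    · refine lintegral_congr fun n => ?_
      rw [hκ hg (by fun_prop)]
    · fun_prop
  · filter_upwards [hcf, hcg] with w h1 h2
    rw [Kernel.prod_apply, Kernel.prod_apply, h1, h2]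

/-- The bivariate Gaussian law with means `mx`, `my`, standard deviations `sx`, `sy` and
correlation coefficient `ρ`. -/
noncomputable def gaussianPair (mx my sx sy ρ : ℝ) : Measure (ℝ × ℝ) :=
  ((gaussianReal 0 1).prod (gaussianReal 0 1)).map
    fun q => (mx + sx * q.1, (my + sy * (ρ * q.1)) + (sy * √(1 - ρ ^ 2)) * q.2)

/-- The law of `((mx + sx (α W + d N₁), my + sy (β W + d N₂)), W)` for independent standard
Gaussians `W`, `N₁`, `N₂`. -/
noncomputable def gaussianCoupling (mx my sx sy α β d : ℝ) : Measure ((ℝ × ℝ) × ℝ) :=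
  ((gaussianReal 0 1).prod ((gaussianReal 0 1).prod (gaussianReal 0 1))).map
    fun q => (((mx + sx * (α * q.1)) + (sx * d) * q.2.1,
      (my + sy * (β * q.1)) + (sy * d) * q.2.2), q.1)

/-- The logarithm of the density, with respect to a bivariate Gaussian law with correlation
coefficient `ρ`, of the product of Gaussian laws with means `mx + sx a`, `my + sy b` and variances
`sx² (1 - |ρ|)`, `sy² (1 - |ρ|)`. -/
noncomputable def wynerLogDensity (mx my sx sy ρ : ℝ) (p : ℝ × ℝ) (a b : ℝ) : ℝ :=
  1 / 2 * log ((1 + |ρ|) / (1 - |ρ|))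
    - (((p.1 - mx) / sx - a) ^ 2 + ((p.2 - my) / sy - b) ^ 2) / (2 * (1 - |ρ|))
    + (((p.1 - mx) / sx) ^ 2 - 2 * ρ * (((p.1 - mx) / sx) * ((p.2 - my) / sy))
      + ((p.2 - my) / sy) ^ 2) / (2 * (1 - ρ ^ 2))

instance isProbabilityMeasure_gaussianPair (mx my sx sy ρ : ℝ) :
    IsProbabilityMeasure (gaussianPair mx my sx sy ρ) :=
  Measure.isProbabilityMeasure_map (by fun_prop)

instance isProbabilityMeasure_gaussianCoupling (mx my sx sy α β d : ℝ) :
    IsProbabilityMeasure (gaussianCoupling mx my sx sy α β d) :=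
  Measure.isProbabilityMeasure_map (by fun_prop)

lemma integral_cexp_gaussianPair (mx my sx sy : ℝ) {ρ : ℝ} (hρ : |ρ| < 1) (a b : ℝ) :
    ∫ p, Complex.exp (((a * p.1 + b * p.2 : ℝ) : ℂ) * Complex.I) ∂gaussianPair mx my sx sy ρ =
      Complex.exp (((a * mx + b * my : ℝ) : ℂ) * Complex.I
        - (((a ^ 2 * sx ^ 2 + 2 * a * b * (ρ * sx * sy) + b ^ 2 * sy ^ 2) / 2 : ℝ) : ℂ)) := by
  have hr : √(1 - ρ ^ 2) ^ 2 = 1 - ρ ^ 2 := by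
    rw [sq_sqrt]; nlinarith [sq_abs ρ, abs_nonneg ρ]
  rw [gaussianPair, integral_map (by fun_prop) (by fun_prop)]
  have h : ∀ q : ℝ × ℝ, Complex.exp (((a * (mx + sx * q.1)
      + b * ((my + sy * (ρ * q.1)) + (sy * √(1 - ρ ^ 2)) * q.2) : ℝ) : ℂ) * Complex.I) =
      Complex.exp (((a * mx + b * my : ℝ) : ℂ) * Complex.I) *
      (Complex.exp ((((a * sx + b * sy * ρ) * q.1 : ℝ) : ℂ) * Complex.I) *
      Complex.exp ((((b * sy * √(1 - ρ ^ 2)) * q.2 : ℝ) : ℂ) * Complex.I)) := by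
    intro q
    rw [← Complex.exp_add, ← Complex.exp_add]
    congr 1
    push_cast
    ring
  simp_rw [h]
  rw [integral_const_mul, integral_prod_mul
    (fun n : ℝ => Complex.exp ((((a * sx + b * sy * ρ) * n : ℝ) : ℂ) * Complex.I))
    (fun n : ℝ => Complex.exp ((((b * sy * √(1 - ρ ^ 2)) * n : ℝ) : ℂ) * Complex.I)),
    integral_cexp_gaussianReal,
    integral_cexp_gaussianReal, ← Complex.exp_add, ← Complex.exp_add]
  rw [sub_eq_add_neg (((a * mx + b * my : ℝ) : ℂ) * Complex.I)]
  simp only [← Complex.ofReal_neg, ← Complex.ofReal_add]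
  congr 3
  linear_combination (-(b ^ 2 * sy ^ 2) / 2) * hr

lemma integral_cexp_gaussianCoupling (mx my sx sy : ℝ) {ρ α β d : ℝ} (hα : α ^ 2 = |ρ|)
    (hβ : β ^ 2 = |ρ|) (hαβ : α * β = ρ) (hd : d ^ 2 = 1 - |ρ|) (a b : ℝ) :
    ∫ p, Complex.exp (((a * p.1 + b * p.2 : ℝ) : ℂ) * Complex.I)
        ∂(gaussianCoupling mx my sx sy α β d).map Prod.fst =
      Complex.exp (((a * mx + b * my : ℝ) : ℂ) * Complex.I
        - (((a ^ 2 * sx ^ 2 + 2 * a * b * (ρ * sx * sy) + b ^ 2 * sy ^ 2) / 2 : ℝ) : ℂ)) := by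
  rw [integral_map (by fun_prop) (by fun_prop), gaussianCoupling,
    integral_map (by fun_prop) (by fun_prop)]
  have h : ∀ q : ℝ × ℝ × ℝ, Complex.exp (((a * ((mx + sx * (α * q.1)) + (sx * d) * q.2.1)
      + b * ((my + sy * (β * q.1)) + (sy * d) * q.2.2) : ℝ) : ℂ) * Complex.I) =
      Complex.exp (((a * mx + b * my : ℝ) : ℂ) * Complex.I) *
      (Complex.exp ((((a * sx * α + b * sy * β) * q.1 : ℝ) : ℂ) * Complex.I) *
      (fun n : ℝ × ℝ => Complex.exp ((((a * sx * d) * n.1 : ℝ) : ℂ) * Complex.I) *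
      Complex.exp ((((b * sy * d) * n.2 : ℝ) : ℂ) * Complex.I)) q.2) := by
    intro q
    simp only
    rw [← Complex.exp_add, ← Complex.exp_add, ← Complex.exp_add]
    congr 1
    push_cast
    ring
  simp_rw [h]
  rw [integral_const_mul, integral_prod_mul
    (fun w : ℝ => Complex.exp ((((a * sx * α + b * sy * β) * w : ℝ) : ℂ) * Complex.I))
    (fun n : ℝ × ℝ => Complex.exp ((((a * sx * d) * n.1 : ℝ) : ℂ) * Complex.I) *
      Complex.exp ((((b * sy * d) * n.2 : ℝ) : ℂ) * Complex.I)),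
    integral_prod_mul
    (fun n : ℝ => Complex.exp ((((a * sx * d) * n : ℝ) : ℂ) * Complex.I))
    (fun n : ℝ => Complex.exp ((((b * sy * d) * n : ℝ) : ℂ) * Complex.I)),
    integral_cexp_gaussianReal, integral_cexp_gaussianReal, integral_cexp_gaussianReal,
    ← Complex.exp_add, ← Complex.exp_add, ← Complex.exp_add]
  simp only [sub_eq_add_neg, ← Complex.ofReal_neg, ← Complex.ofReal_add]
  congr 3
  linear_combination (-(a ^ 2 * sx ^ 2) / 2) * hα + (-(b ^ 2 * sy ^ 2) / 2) * hβ
    - a * b * sx * sy * hαβ + (-(a ^ 2 * sx ^ 2 + b ^ 2 * sy ^ 2) / 2) * hd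

lemma map_fst_gaussianCoupling (mx my sx sy : ℝ) {ρ α β d : ℝ} (hρ : |ρ| < 1) (hα : α ^ 2 = |ρ|)
    (hβ : β ^ 2 = |ρ|) (hαβ : α * β = ρ) (hd : d ^ 2 = 1 - |ρ|) :
    (gaussianCoupling mx my sx sy α β d).map Prod.fst = gaussianPair mx my sx sy ρ := by
  have : IsProbabilityMeasure ((gaussianCoupling mx my sx sy α β d).map Prod.fst) :=
    Measure.isProbabilityMeasure_map (by fun_prop)
  refine ext_of_integral_cexp fun a b => ?_
  rw [integral_cexp_gaussianPair _ _ _ _ hρ,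
    integral_cexp_gaussianCoupling _ _ _ _ hα hβ hαβ hd]

lemma map_snd_gaussianCoupling (mx my sx sy α β d : ℝ) :
    (gaussianCoupling mx my sx sy α β d).map Prod.snd = gaussianReal 0 1 := by
  rw [gaussianCoupling, Measure.map_map (by fun_prop) (by fun_prop)]
  exact Measure.fst_prod

lemma lintegral_gaussianPair (mx my : ℝ) {sx sy ρ : ℝ} (hsx : 0 < sx) (hsy : 0 < sy)
    (hρ : |ρ| < 1) {h : ℝ × ℝ → ℝ≥0∞} (hh : Measurable h) :
    ∫⁻ p, h p ∂gaussianPair mx my sx sy ρ =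
      ∫⁻ x, ∫⁻ y, gaussianPDF mx (sx ^ 2).toNNReal x *
        gaussianPDF (my + sy * (ρ * ((x - mx) / sx))) ((sy * √(1 - ρ ^ 2)) ^ 2).toNNReal y
          * h (x, y) := by
  have hr : 0 < √(1 - ρ ^ 2) := sqrt_pos.mpr (by nlinarith [sq_abs ρ, abs_nonneg ρ])
  have hr' : sy * √(1 - ρ ^ 2) ≠ 0 := by positivity
  rw [gaussianPair, lintegral_map hh (by fun_prop), lintegral_prod _ (by fun_prop)]
  have h1 : ∀ u : ℝ, ∫⁻ v, h (mx + sx * u, (my + sy * (ρ * u)) + (sy * √(1 - ρ ^ 2)) * v)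
      ∂gaussianReal 0 1 = (fun x => ∫⁻ y, gaussianPDF (my + sy * (ρ * ((x - mx) / sx)))
        ((sy * √(1 - ρ ^ 2)) ^ 2).toNNReal y * h (x, y)) (mx + sx * u) := by
    intro u
    rw [lintegral_gaussianReal_affine (h := fun y => h (mx + sx * u, y)) (by fun_prop) _ hr']
    simp only [add_sub_cancel_left, mul_div_cancel_left₀ u hsx.ne']
  simp only [h1]
  have hm : Measurable fun x => ∫⁻ y, gaussianPDF (my + sy * (ρ * ((x - mx) / sx)))
        ((sy * √(1 - ρ ^ 2)) ^ 2).toNNReal y * h (x, y) := by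
    refine Measurable.lintegral_prod_right' (f := fun q : ℝ × ℝ =>
      gaussianPDF (my + sy * (ρ * ((q.1 - mx) / sx)))
        ((sy * √(1 - ρ ^ 2)) ^ 2).toNNReal q.2 * h (q.1, q.2)) ?_
    exact (measurable_uncurry_gaussianPDF.comp (f := fun q : ℝ × ℝ =>
      (my + sy * (ρ * ((q.1 - mx) / sx)), ((sy * √(1 - ρ ^ 2)) ^ 2).toNNReal, q.2))
      (by fun_prop)).mul (by fun_prop)
  rw [lintegral_gaussianReal_affine (h := fun x => ∫⁻ y, _) hm _ hsx.ne']
  refine lintegral_congr fun x => ?_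
  rw [← lintegral_const_mul _ (by fun_prop)]
  simp only [mul_assoc]

lemma lintegral_gaussianCoupling (mx my : ℝ) {sx sy α β d : ℝ} (hsx : 0 < sx) (hsy : 0 < sy)
    (hd : 0 < d) {h : (ℝ × ℝ) × ℝ → ℝ≥0∞} (hh : Measurable h) :
    ∫⁻ p, h p ∂gaussianCoupling mx my sx sy α β d =
      ∫⁻ w, (∫⁻ x, ∫⁻ y, gaussianPDF (mx + sx * (α * w)) ((sx * d) ^ 2).toNNReal x *
        gaussianPDF (my + sy * (β * w)) ((sy * d) ^ 2).toNNReal y * h ((x, y), w))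
          ∂gaussianReal 0 1 := by
  rw [gaussianCoupling, lintegral_map hh (by fun_prop), lintegral_prod _ (by fun_prop)]
  refine lintegral_congr fun w => ?_
  rw [lintegral_prod _ (by fun_prop)]
  have h1 : ∀ u : ℝ, ∫⁻ v, h (((mx + sx * (α * w)) + (sx * d) * u,
      (my + sy * (β * w)) + (sy * d) * v), w)
      ∂gaussianReal 0 1 = (fun x => ∫⁻ y, gaussianPDF (my + sy * (β * w))
        ((sy * d) ^ 2).toNNReal y * h ((x, y), w)) ((mx + sx * (α * w)) + (sx * d) * u) := by
    intro u
    rw [lintegral_gaussianReal_affine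
      (h := fun y => h (((mx + sx * (α * w)) + (sx * d) * u, y), w)) (by fun_prop) _
      (by positivity)]
  simp only [h1]
  rw [lintegral_gaussianReal_affine (h := fun x => ∫⁻ y, gaussianPDF (my + sy * (β * w))
    ((sy * d) ^ 2).toNNReal y * h ((x, y), w)) (by fun_prop) _ (by positivity)]
  refine lintegral_congr fun x => ?_
  rw [← lintegral_const_mul _ (by fun_prop)]
  simp only [mul_assoc]

lemma gaussianPDFReal_sq (m x : ℝ) {s : ℝ} (hs : 0 < s) :
    gaussianPDFReal m (s ^ 2).toNNReal x = (√(2 * π) * s)⁻¹ * exp (-((x - m) / s) ^ 2 / 2) := by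
  rw [gaussianPDFReal, Real.coe_toNNReal _ (sq_nonneg s), sqrt_mul (by positivity),
    sqrt_sq hs.le]
  congr 2
  field_simp

lemma gaussianPDF_mul_exp_wynerLogDensity (mx my : ℝ) {sx sy ρ d : ℝ} (hsx : 0 < sx)
    (hsy : 0 < sy) (hρ : |ρ| < 1) (hd0 : 0 < d) (hd : d ^ 2 = 1 - |ρ|) (x y a b : ℝ) :
    gaussianPDF mx (sx ^ 2).toNNReal x *
        gaussianPDF (my + sy * (ρ * ((x - mx) / sx))) ((sy * √(1 - ρ ^ 2)) ^ 2).toNNReal y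
          * ENNReal.ofReal (exp (wynerLogDensity mx my sx sy ρ (x, y) a b)) =
      gaussianPDF (mx + sx * a) ((sx * d) ^ 2).toNNReal x *
        gaussianPDF (my + sy * b) ((sy * d) ^ 2).toNNReal y := by
  have hρ2 : 0 < 1 - ρ ^ 2 := by nlinarith [sq_abs ρ, abs_nonneg ρ]
  have hr : 0 < √(1 - ρ ^ 2) := sqrt_pos.mpr hρ2
  have hre : √(1 - ρ ^ 2) = d * √(1 + |ρ|) := by
    rw [← sqrt_sq hd0.le, ← sqrt_mul (sq_nonneg d), hd, ← sq_abs ρ]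
    congr 1; ring
  have he : 0 < √(1 + |ρ|) := sqrt_pos.mpr (by positivity)
  have hK : exp (1 / 2 * log ((1 + |ρ|) / (1 - |ρ|))) = √(1 + |ρ|) / d := by
    rw [← hd, log_div (by positivity) (by positivity), log_pow, mul_sub, exp_sub,
      show 1 / 2 * log (1 + |ρ|) = log √(1 + |ρ|) by rw [log_sqrt (by positivity)]; ring,
      exp_log he, show 1 / 2 * (((2 : ℕ) : ℝ) * log d) = log d by push_cast; ring, exp_log hd0]
  simp only [gaussianPDF]
  rw [← ENNReal.ofReal_mul (gaussianPDFReal_nonneg _ _ _),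
    ← ENNReal.ofReal_mul (mul_nonneg (gaussianPDFReal_nonneg _ _ _) (gaussianPDFReal_nonneg _ _ _)),
    ← ENNReal.ofReal_mul (gaussianPDFReal_nonneg _ _ _)]
  congr 1
  rw [gaussianPDFReal_sq _ _ hsx, gaussianPDFReal_sq _ _ (by positivity),
    gaussianPDFReal_sq _ _ (by positivity), gaussianPDFReal_sq _ _ (by positivity)]
  obtain ⟨u, rfl⟩ : ∃ u, x = mx + sx * u := ⟨(x - mx) / sx, by field_simp; ring⟩
  obtain ⟨v, rfl⟩ : ∃ v, y = my + sy * v := ⟨(y - my) / sy, by field_simp; ring⟩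
  have e1 : (mx + sx * u - mx) / sx = u := by field_simp; ring
  have e2 : (my + sy * v - my) / sy = v := by field_simp; ring
  rw [wynerLogDensity, sub_add, exp_sub, hK]
  simp only [e1, e2]
  have e3 : (my + sy * v - (my + sy * (ρ * u))) / (sy * √(1 - ρ ^ 2)) =
      (v - ρ * u) / √(1 - ρ ^ 2) := by field_simp; ring
  have e4 : (mx + sx * u - (mx + sx * a)) / (sx * d) = (u - a) / d := by field_simp; ring
  have e5 : (my + sy * v - (my + sy * b)) / (sy * d) = (v - b) / d := by field_simp; ring
  rw [e3, e4, e5, div_pow, div_pow, div_pow, sq_sqrt hρ2.le, ← hd]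
  have hexp : exp (-u ^ 2 / 2) * exp (-((v - ρ * u) ^ 2 / (1 - ρ ^ 2)) / 2) /
      exp (((u - a) ^ 2 + (v - b) ^ 2) / (2 * d ^ 2)
        - (u ^ 2 - 2 * ρ * (u * v) + v ^ 2) / (2 * (1 - ρ ^ 2))) =
      exp (-((u - a) ^ 2 / d ^ 2) / 2) * exp (-((v - b) ^ 2 / d ^ 2) / 2) := by
    rw [← exp_add, ← exp_add, ← exp_sub]
    congr 1
    field_simp
    ring
  have hc : (√(2 * π) * sx)⁻¹ * (√(2 * π) * (sy * √(1 - ρ ^ 2)))⁻¹ * (√(1 + |ρ|) / d) =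
      (√(2 * π) * (sx * d))⁻¹ * (√(2 * π) * (sy * d))⁻¹ := by
    rw [hre]
    have : 0 < √(2 * π) := by positivity
    field_simp
  calc _ = ((√(2 * π) * sx)⁻¹ * (√(2 * π) * (sy * √(1 - ρ ^ 2)))⁻¹ * (√(1 + |ρ|) / d)) *
      (exp (-u ^ 2 / 2) * exp (-((v - ρ * u) ^ 2 / (1 - ρ ^ 2)) / 2) /
      exp (((u - a) ^ 2 + (v - b) ^ 2) / (2 * d ^ 2)
        - (u ^ 2 - 2 * ρ * (u * v) + v ^ 2) / (2 * (1 - ρ ^ 2)))) := by ring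
    _ = _ := by rw [hexp, hc]; ring

@[fun_prop]
lemma Measurable.wynerLogDensity {E : Type*} [MeasurableSpace E] {p : E → ℝ × ℝ} {a b : E → ℝ}
    (hp : Measurable p) (ha : Measurable a) (hb : Measurable b) (mx my sx sy ρ : ℝ) :
    Measurable fun e => wynerLogDensity mx my sx sy ρ (p e) (a e) (b e) := by
  unfold _root_.wynerLogDensity
  fun_prop

lemma sqrt_one_sub_abs_sq {ρ : ℝ} (hρ : |ρ| < 1) :
    0 < √(1 - |ρ|) ∧ √(1 - |ρ|) ^ 2 = 1 - |ρ| :=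
  ⟨sqrt_pos.mpr (by linarith), sq_sqrt (by linarith)⟩

lemma lintegral_exp_wynerLogDensity (mx my : ℝ) {sx sy ρ : ℝ} (hsx : 0 < sx) (hsy : 0 < sy)
    (hρ : |ρ| < 1) (κ : Measure ℝ) [IsProbabilityMeasure κ] {a b : ℝ → ℝ} (ha : Measurable a)
    (hb : Measurable b) :
    ∫⁻ p, ENNReal.ofReal (exp (wynerLogDensity mx my sx sy ρ p.1 (a p.2) (b p.2)))
      ∂(gaussianPair mx my sx sy ρ).prod κ = 1 := by
  obtain ⟨hd0, hd⟩ := sqrt_one_sub_abs_sq hρ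
  rw [lintegral_prod_symm _ (by fun_prop)]
  have h : ∀ w, ∫⁻ p, ENNReal.ofReal (exp (wynerLogDensity mx my sx sy ρ p (a w) (b w)))
      ∂gaussianPair mx my sx sy ρ = 1 := by
    intro w
    have h1 : ((sx * √(1 - |ρ|)) ^ 2).toNNReal ≠ 0 := by
      rw [ne_eq, Real.toNNReal_eq_zero, not_le]; positivity
    have h2 : ((sy * √(1 - |ρ|)) ^ 2).toNNReal ≠ 0 := by
      rw [ne_eq, Real.toNNReal_eq_zero, not_le]; positivity
    rw [lintegral_gaussianPair _ _ hsx hsy hρ (by fun_prop)]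
    simp_rw [gaussianPDF_mul_exp_wynerLogDensity mx my hsx hsy hρ hd0 hd]
    simp_rw [lintegral_const_mul _ (measurable_gaussianPDF _ _)]
    simp [h1, h2]
  simp [h]

lemma gaussianCoupling_eq_withDensity (mx my : ℝ) {sx sy ρ α β d : ℝ} (hsx : 0 < sx)
    (hsy : 0 < sy) (hρ : |ρ| < 1) (hd0 : 0 < d) (hd : d ^ 2 = 1 - |ρ|) :
    gaussianCoupling mx my sx sy α β d =
      ((gaussianPair mx my sx sy ρ).prod (gaussianReal 0 1)).withDensity fun p =>
        ENNReal.ofReal (exp (wynerLogDensity mx my sx sy ρ p.1 (α * p.2) (β * p.2))) := by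
  refine Measure.ext_of_lintegral _ fun h hh => ?_
  rw [lintegral_gaussianCoupling _ _ hsx hsy hd0 hh,
    lintegral_withDensity_eq_lintegral_mul _ (by fun_prop) hh]
  rw [lintegral_prod_symm _ (by fun_prop)]
  refine lintegral_congr fun w => ?_
  rw [lintegral_gaussianPair _ _ hsx hsy hρ (by fun_prop)]
  refine lintegral_congr fun x => lintegral_congr fun y => ?_
  rw [← gaussianPDF_mul_exp_wynerLogDensity mx my hsx hsy hρ hd0 hd x y (α * w) (β * w), mul_assoc]
  rfl

lemma memLp_id_gaussianReal_two : MemLp (fun x : ℝ => x) 2 (gaussianReal 0 1) :=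
  memLp_id_gaussianReal' 2 (by simp)

lemma integral_sq_gaussianReal : ∫ x, x ^ 2 ∂gaussianReal 0 1 = 1 := by
  have h := variance_id_gaussianReal (μ := 0) (v := 1)
  rw [variance_eq_integral (by fun_prop)] at h
  simpa using h

lemma moments_of_map_eq_gaussianPair {E : Type*} [MeasurableSpace E] {ν : Measure E}
    {mx my sx sy ρ : ℝ} (hsx : 0 < sx) (hsy : 0 < sy)
    (hρ : |ρ| < 1) {Z : E → ℝ × ℝ} (hZ : Measurable Z)
    (h : ν.map Z = gaussianPair mx my sx sy ρ) :
    MemLp (fun e => ((Z e).1 - mx) / sx) 2 ν ∧ MemLp (fun e => ((Z e).2 - my) / sy) 2 ν ∧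
    ∫ e, (((Z e).1 - mx) / sx) ^ 2 ∂ν = 1 ∧ ∫ e, (((Z e).2 - my) / sy) ^ 2 ∂ν = 1 ∧
    ∫ e, (((Z e).1 - mx) / sx) * (((Z e).2 - my) / sy) ∂ν = ρ := by
  set G := gaussianReal 0 1 with hG
  set T : ℝ × ℝ → ℝ × ℝ :=
    fun q => (mx + sx * q.1, (my + sy * (ρ * q.1)) + (sy * √(1 - ρ ^ 2)) * q.2) with hT
  have hTm : Measurable T := by fun_prop
  have hr : √(1 - ρ ^ 2) ^ 2 = 1 - ρ ^ 2 := by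
    rw [sq_sqrt]; nlinarith [sq_abs ρ, abs_nonneg ρ]
  have hX : (fun q => ((T q).1 - mx) / sx) = fun q : ℝ × ℝ => q.1 := by
    funext q; simp only [hT]; field_simp; ring
  have hY : (fun q => ((T q).2 - my) / sy) = fun q : ℝ × ℝ => ρ * q.1 + √(1 - ρ ^ 2) * q.2 := by
    funext q; simp only [hT]; field_simp; ring
  have hint : ∀ {φ : ℝ × ℝ → ℝ}, Measurable φ → ∫ e, φ (Z e) ∂ν = ∫ q, φ (T q) ∂G.prod G := by
    intro φ hφ
    rw [← integral_map hZ.aemeasurable hφ.aestronglyMeasurable, h, gaussianPair,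
      integral_map hTm.aemeasurable hφ.aestronglyMeasurable]
  have hmem : ∀ {φ : ℝ × ℝ → ℝ}, Measurable φ → MemLp (φ ∘ T) 2 (G.prod G) →
      MemLp (φ ∘ Z) 2 ν := by
    intro φ hφ hφ2
    rw [← memLp_map_measure_iff hφ.aestronglyMeasurable hZ.aemeasurable, h, gaussianPair,
      memLp_map_measure_iff hφ.aestronglyMeasurable hTm.aemeasurable]
    exact hφ2
  have m1 : MemLp (fun q : ℝ × ℝ => q.1) 2 (G.prod G) :=
    memLp_id_gaussianReal_two.comp_measurePreserving measurePreserving_fst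
  have m2 : MemLp (fun q : ℝ × ℝ => q.2) 2 (G.prod G) :=
    memLp_id_gaussianReal_two.comp_measurePreserving measurePreserving_snd
  have i1 : ∫ q, q.1 ^ 2 ∂G.prod G = 1 := by
    refine (integral_fun_fst (μ := G) (ν := G) fun x : ℝ => x ^ 2).trans ?_
    rw [hG, integral_sq_gaussianReal, probReal_univ, one_smul]
  have i2 : ∫ q, q.2 ^ 2 ∂G.prod G = 1 := by
    refine (integral_fun_snd (μ := G) (ν := G) fun x : ℝ => x ^ 2).trans ?_
    rw [hG, integral_sq_gaussianReal, probReal_univ, one_smul]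
  have i3 : ∫ q, q.1 * q.2 ∂G.prod G = 0 := by
    rw [integral_prod_mul (fun x : ℝ => x) fun x => x]
    simp [hG]
  have j1 : Integrable (fun q : ℝ × ℝ => q.1 ^ 2) (G.prod G) := m1.integrable_sq
  have j2 : Integrable (fun q : ℝ × ℝ => q.2 ^ 2) (G.prod G) := m2.integrable_sq
  have j3 : Integrable (fun q : ℝ × ℝ => q.1 * q.2) (G.prod G) := m1.integrable_mul m2
  refine ⟨hmem (φ := fun p => (p.1 - mx) / sx) (by fun_prop) ?_,
    hmem (φ := fun p => (p.2 - my) / sy) (by fun_prop) ?_, ?_, ?_, ?_⟩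
  · change MemLp (fun q => ((T q).1 - mx) / sx) 2 _
    rw [hX]; exact m1
  · change MemLp (fun q => ((T q).2 - my) / sy) 2 _
    rw [hY]; exact (m1.const_mul ρ).add (m2.const_mul _)
  · rw [hint (φ := fun p => ((p.1 - mx) / sx) ^ 2) (by fun_prop), ← i1]
    exact integral_congr_ae (ae_of_all _ fun q => congrArg (· ^ 2) (congrFun hX q))
  · rw [hint (φ := fun p => ((p.2 - my) / sy) ^ 2) (by fun_prop)]
    have : ∀ q, (((T q).2 - my) / sy) ^ 2 =
        ρ ^ 2 * q.1 ^ 2 + (1 - ρ ^ 2) * q.2 ^ 2 + (2 * ρ * √(1 - ρ ^ 2)) * (q.1 * q.2) := by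
      intro q
      rw [congrFun hY q]; linear_combination q.2 ^ 2 * hr
    simp_rw [this]
    have j : Integrable (fun q : ℝ × ℝ => ρ ^ 2 * q.1 ^ 2 + (1 - ρ ^ 2) * q.2 ^ 2) (G.prod G) :=
      (j1.const_mul _).add (j2.const_mul _)
    rw [integral_add j (j3.const_mul _),
      integral_add (j1.const_mul _) (j2.const_mul _), integral_const_mul, integral_const_mul,
      integral_const_mul, i1, i2, i3]
    ring
  · rw [hint (φ := fun p => ((p.1 - mx) / sx) * ((p.2 - my) / sy)) (by fun_prop)]
    have : ∀ q, (((T q).1 - mx) / sx) * (((T q).2 - my) / sy) =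
        ρ * q.1 ^ 2 + √(1 - ρ ^ 2) * (q.1 * q.2) := by
      intro q
      rw [congrFun hX q, congrFun hY q]; ring
    simp_rw [this]
    rw [integral_add (j1.const_mul _) (j3.const_mul _), integral_const_mul,
      integral_const_mul, i1, i3]
    ring

lemma integral_wynerLogDensity {E : Type*} [MeasurableSpace E] {ν : Measure E}
    [IsProbabilityMeasure ν] {mx my sx sy ρ : ℝ} (hsx : 0 < sx) (hsy : 0 < sy)
    (hρ : |ρ| < 1) {Z : E → ℝ × ℝ} (hZ : Measurable Z)
    (h : ν.map Z = gaussianPair mx my sx sy ρ) {A B : E → ℝ} (hA : MemLp A 2 ν)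
    (hB : MemLp B 2 ν) :
    Integrable (fun e => wynerLogDensity mx my sx sy ρ (Z e) (A e) (B e)) ν ∧
    ∫ e, wynerLogDensity mx my sx sy ρ (Z e) (A e) (B e) ∂ν =
      1 / 2 * log ((1 + |ρ|) / (1 - |ρ|)) + 1
        - (∫ e, (((Z e).1 - mx) / sx - A e) ^ 2 ∂ν + ∫ e, (((Z e).2 - my) / sy - B e) ^ 2 ∂ν)
          / (2 * (1 - |ρ|)) := by
  obtain ⟨hU, hV, i1, i2, i3⟩ := moments_of_map_eq_gaussianPair hsx hsy hρ hZ h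
  have hρ2 : 0 < 1 - ρ ^ 2 := by nlinarith [sq_abs ρ, abs_nonneg ρ]
  set U := fun e => ((Z e).1 - mx) / sx with hUdef
  set V := fun e => ((Z e).2 - my) / sy with hVdef
  have j1 : Integrable (fun e => U e ^ 2) ν := hU.integrable_sq
  have j2 : Integrable (fun e => V e ^ 2) ν := hV.integrable_sq
  have j3 : Integrable (fun e => U e * V e) ν := hU.integrable_mul hV
  have j4 : Integrable (fun e => (U e - A e) ^ 2) ν := (hU.sub hA).integrable_sq
  have j5 : Integrable (fun e => (V e - B e) ^ 2) ν := (hV.sub hB).integrable_sq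
  have j45 : Integrable (fun e => (U e - A e) ^ 2 + (V e - B e) ^ 2) ν := j4.add j5
  have j13 : Integrable (fun e => U e ^ 2 - 2 * ρ * (U e * V e)) ν := j1.sub (j3.const_mul _)
  have k1 : Integrable (fun e => (1 / 2 * log ((1 + |ρ|) / (1 - |ρ|)) : ℝ) -
      ((U e - A e) ^ 2 + (V e - B e) ^ 2) / (2 * (1 - |ρ|))) ν :=
    (integrable_const _).sub (j45.div_const _)
  have k2 : Integrable (fun e => (U e ^ 2 - 2 * ρ * (U e * V e) + V e ^ 2)) ν :=
    j13.add j2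
  have hf : (fun e => wynerLogDensity mx my sx sy ρ (Z e) (A e) (B e)) = fun e =>
      ((1 / 2 * log ((1 + |ρ|) / (1 - |ρ|)) : ℝ) -
      ((U e - A e) ^ 2 + (V e - B e) ^ 2) / (2 * (1 - |ρ|))) +
      (U e ^ 2 - 2 * ρ * (U e * V e) + V e ^ 2) / (2 * (1 - ρ ^ 2)) := rfl
  rw [hf]
  refine ⟨k1.add (k2.div_const _), ?_⟩
  rw [integral_add k1 (k2.div_const _), integral_sub (integrable_const _) (j45.div_const _),
    integral_div, integral_div, integral_add j4 j5, integral_add j13 j2,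
    integral_sub j1 (j3.const_mul _), integral_const_mul (2 * ρ), i1, i2, i3]
  simp only [integral_const, probReal_univ, one_smul]
  have : (1 - 2 * ρ * ρ + 1) / (2 * (1 - ρ ^ 2)) = 1 := by
    rw [div_eq_one_iff_eq (by positivity)]; ring
  rw [this]; ring

/-- If `U` and `V` have unit variance and are conditionally independent given `m'`, then the mean
squared errors of their conditional expectations sum to at most `2 (1 - |E[UV]|)`. -/
lemma integral_sub_condExp_sq_add_le {E : Type*} {m' mE : MeasurableSpace E} (hm : m' ≤ mE)
    {ν : Measure E} [IsProbabilityMeasure ν] {U V : E → ℝ} (hU : MemLp U 2 ν) (hV : MemLp V 2 ν)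
    (hU1 : ∫ e, U e ^ 2 ∂ν = 1) (hV1 : ∫ e, V e ^ 2 ∂ν = 1)
    (h : ν[fun e => U e * V e | m'] =ᵐ[ν] fun e => (ν[U | m']) e * (ν[V | m']) e) :
    ∫ e, (U e - (ν[U | m']) e) ^ 2 ∂ν + ∫ e, (V e - (ν[V | m']) e) ^ 2 ∂ν ≤
      2 * (1 - |∫ e, U e * V e ∂ν|) := by
  have key : ∀ {W : E → ℝ}, MemLp W 2 ν →
      ∫ e, (W e - (ν[W | m']) e) ^ 2 ∂ν = ∫ e, W e ^ 2 ∂ν - ∫ e, (ν[W | m']) e ^ 2 ∂ν := by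
    intro W hW
    have hA : MemLp (ν[W | m']) 2 ν := hW.condExp (by norm_num)
    have hWA : Integrable (fun e => W e * (ν[W | m']) e) ν := hW.integrable_mul hA
    have h1 : ∫ e, W e * (ν[W | m']) e ∂ν = ∫ e, (ν[W | m']) e ^ 2 ∂ν := by
      rw [← integral_condExp hm]
      refine integral_congr_ae ?_
      filter_upwards [condExp_mul_of_stronglyMeasurable_right (μ := ν) (f := W)
        (stronglyMeasurable_condExp (f := W) (m := m') (μ := ν)) hWA
        (hW.integrable (by norm_num))] with e he
      exact he.trans (by simp [sq])
    have h2 : ∀ e, (W e - (ν[W | m']) e) ^ 2 =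
        W e ^ 2 - 2 * (W e * (ν[W | m']) e) + (ν[W | m']) e ^ 2 := fun e => by ring
    simp_rw [h2]
    have hi : Integrable (fun e => W e ^ 2 - 2 * (W e * (ν[W | m']) e)) ν :=
      hW.integrable_sq.sub (hWA.const_mul 2)
    rw [integral_add hi hA.integrable_sq,
      integral_sub hW.integrable_sq (hWA.const_mul 2), integral_const_mul, h1]
    ring
  have hA : MemLp (ν[U | m']) 2 ν := hU.condExp (by norm_num)
  have hB : MemLp (ν[V | m']) 2 ν := hV.condExp (by norm_num)
  have hUV : ∫ e, U e * V e ∂ν = ∫ e, (ν[U | m']) e * (ν[V | m']) e ∂ν := by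
    rw [← integral_condExp hm]; exact integral_congr_ae h
  have hle : |∫ e, U e * V e ∂ν| ≤
      (∫ e, (ν[U | m']) e ^ 2 ∂ν + ∫ e, (ν[V | m']) e ^ 2 ∂ν) / 2 := by
    rw [hUV, ← integral_add hA.integrable_sq hB.integrable_sq, ← integral_div]
    refine (abs_integral_le_integral_abs).trans
      (integral_mono (hA.integrable_mul hB).abs
        ((hA.integrable_sq.add hB.integrable_sq).div_const 2) fun e => ?_)
    beta_reduce
    rw [abs_mul, ← sq_abs ((ν[U | m']) e), ← sq_abs ((ν[V | m']) e)]
    nlinarith [sq_nonneg (|(ν[U | m']) e| - |(ν[V | m']) e|)]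
  rw [key hU, key hV, hU1, hV1]
  linarith

lemma map_prodMk_eq_gaussianPair {Ω : Type*} [MeasurableSpace Ω] {μ : Measure Ω}
    [IsProbabilityMeasure μ] {X Y : Ω → ℝ} (hX : Measurable X) (hY : Measurable Y)
    (hGauss : ∀ a b : ℝ, ∃ (m : ℝ) (v : ℝ≥0),
      μ.map (fun ω => a * X ω + b * Y ω) = gaussianReal m v) {sx sy ρ : ℝ}
    (hsx : ∫ ω, (X ω - ∫ x, X x ∂μ) ^ 2 ∂μ = sx ^ 2)
    (hsy : ∫ ω, (Y ω - ∫ x, Y x ∂μ) ^ 2 ∂μ = sy ^ 2)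
    (hcov : ∫ ω, (X ω - ∫ x, X x ∂μ) * (Y ω - ∫ x, Y x ∂μ) ∂μ = ρ * sx * sy)
    (hρ : |ρ| < 1) :
    μ.map (fun ω => (X ω, Y ω)) = gaussianPair (∫ ω, X ω ∂μ) (∫ ω, Y ω ∂μ) sx sy ρ := by
  have hLp : ∀ {Z : Ω → ℝ}, Measurable Z →
      (∃ (m : ℝ) (v : ℝ≥0), μ.map Z = gaussianReal m v) → MemLp Z 2 μ := by
    rintro Z hZ ⟨m, v, h⟩
    have := memLp_id_gaussianReal' (μ := m) (v := v) 2 (by simp)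
    rw [← h] at this
    exact (memLp_map_measure_iff (by fun_prop) hZ.aemeasurable).mp this
  have hX2 : MemLp X 2 μ := hLp hX (by simpa using hGauss 1 0)
  have hY2 : MemLp Y 2 μ := hLp hY (by simpa using hGauss 0 1)
  have hXi : Integrable X μ := hX2.integrable (by norm_num)
  have hYi : Integrable Y μ := hY2.integrable (by norm_num)
  have : IsProbabilityMeasure (μ.map fun ω => (X ω, Y ω)) :=
    Measure.isProbabilityMeasure_map (by fun_prop)
  refine ext_of_integral_cexp fun a b => ?_
  rw [integral_cexp_gaussianPair _ _ _ _ hρ, integral_map (by fun_prop) (by fun_prop)]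
  obtain ⟨m, v, h⟩ := hGauss a b
  have hZ : Measurable fun ω => a * X ω + b * Y ω := by fun_prop
  have hm : m = a * ∫ ω, X ω ∂μ + b * ∫ ω, Y ω ∂μ := by
    rw [← integral_id_gaussianReal (μ := m) (v := v), ← h,
      integral_map hZ.aemeasurable (by fun_prop), integral_add (hXi.const_mul a) (hYi.const_mul b),
      integral_const_mul, integral_const_mul]
  have hv : (v : ℝ) = a ^ 2 * sx ^ 2 + 2 * a * b * (ρ * sx * sy) + b ^ 2 * sy ^ 2 := by
    have hU : MemLp (fun ω => X ω - ∫ x, X x ∂μ) 2 μ := hX2.sub (memLp_const _)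
    have hV : MemLp (fun ω => Y ω - ∫ x, Y x ∂μ) 2 μ := hY2.sub (memLp_const _)
    have h1 : Integrable (fun ω => (X ω - ∫ x, X x ∂μ) ^ 2) μ := hU.integrable_sq
    have h2 : Integrable (fun ω => (Y ω - ∫ x, Y x ∂μ) ^ 2) μ := hV.integrable_sq
    have h3 : Integrable (fun ω => (X ω - ∫ x, X x ∂μ) * (Y ω - ∫ x, Y x ∂μ)) μ :=
      hU.integrable_mul hV
    have h4 : Integrable (fun ω => a ^ 2 * (X ω - ∫ x, X x ∂μ) ^ 2 +
        2 * a * b * ((X ω - ∫ x, X x ∂μ) * (Y ω - ∫ x, Y x ∂μ))) μ :=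
      (h1.const_mul _).add (h3.const_mul _)
    have hsq : ∀ ω, (a * X ω + b * Y ω - m) ^ 2 = a ^ 2 * (X ω - ∫ x, X x ∂μ) ^ 2 +
        2 * a * b * ((X ω - ∫ x, X x ∂μ) * (Y ω - ∫ x, Y x ∂μ)) +
        b ^ 2 * (Y ω - ∫ x, Y x ∂μ) ^ 2 := fun ω => by rw [hm]; ring
    rw [← variance_id_gaussianReal (μ := m) (v := v), variance_eq_integral (by fun_prop)]
    simp only [id]
    rw [integral_id_gaussianReal, ← h, integral_map hZ.aemeasurable (by fun_prop)]
    simp_rw [hsq]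
    rw [integral_add h4 (h2.const_mul _), integral_add (h1.const_mul _) (h3.const_mul _),
      integral_const_mul, integral_const_mul, integral_const_mul, hsx, hsy, hcov]
  have hc := charFun_gaussianReal (μ := m) (v := v) 1
  rw [charFun_apply_real, ← h, integral_map hZ.aemeasurable (by fun_prop)] at hc
  simp only [Complex.ofReal_one, one_mul] at hc
  rw [hc, ← hm, ← hv]
  congr 1
  push_cast
  ring

lemma le_of_condIndepFun_of_miE_eq {mx my sx sy ρ c : ℝ} (hsx : 0 < sx) (hsy : 0 < sy)
    (hρ : |ρ| < 1) {ν : Measure ((ℝ × ℝ) × ℝ)} [IsProbabilityMeasure ν]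
    (hfst : ν.map Prod.fst = gaussianPair mx my sx sy ρ)
    (hci : CondIndepFun (MeasurableSpace.comap Prod.snd inferInstance)
      (MeasurableSpace.comap_le_iff_le_map.mpr measurable_snd.le_map)
      (fun p : (ℝ × ℝ) × ℝ => p.1.1) (fun p => p.1.2) ν)
    (hc : miE ν = c) : 1 / 2 * log ((1 + |ρ|) / (1 - |ρ|)) ≤ c := by
  have hm : MeasurableSpace.comap (Prod.snd : (ℝ × ℝ) × ℝ → ℝ) inferInstance ≤
      (inferInstance : MeasurableSpace ((ℝ × ℝ) × ℝ)) :=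
    MeasurableSpace.comap_le_iff_le_map.mpr measurable_snd.le_map
  obtain ⟨hU, hV, i1, i2, i3⟩ := moments_of_map_eq_gaussianPair hsx hsy hρ measurable_fst hfst
  set U := fun p : (ℝ × ℝ) × ℝ => (p.1.1 - mx) / sx
  set V := fun p : (ℝ × ℝ) × ℝ => (p.1.2 - my) / sy
  have hUV := condExp_mul_ae_eq_of_condIndepFun hm (by fun_prop) (by fun_prop)
    (hU.integrable (by norm_num)) (hV.integrable (by norm_num)) (hU.integrable_mul hV)
    (hci.comp (φ := fun x => (x - mx) / sx) (ψ := fun y => (y - my) / sy)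
      (by fun_prop) (by fun_prop))
  have hle := integral_sub_condExp_sq_add_le hm hU hV i1 i2 hUV
  obtain ⟨a, ha, hA⟩ := (stronglyMeasurable_condExp (f := U) (μ := ν)
    (m := MeasurableSpace.comap Prod.snd inferInstance)).exists_eq_measurable_comp
  obtain ⟨b, hb, hB⟩ := (stronglyMeasurable_condExp (f := V) (μ := ν)
    (m := MeasurableSpace.comap Prod.snd inferInstance)).exists_eq_measurable_comp
  have ha := ha.measurable
  have hb := hb.measurable
  have hA2 : MemLp (fun p : (ℝ × ℝ) × ℝ => a p.2) 2 ν := by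
    change MemLp (a ∘ Prod.snd) 2 ν
    rw [← hA]; exact hU.condExp (by norm_num)
  have hB2 : MemLp (fun p : (ℝ × ℝ) × ℝ => b p.2) 2 ν := by
    change MemLp (b ∘ Prod.snd) 2 ν
    rw [← hB]; exact hV.condExp (by norm_num)
  rw [hA, hB] at hle
  obtain ⟨hgi, hg⟩ := integral_wynerLogDensity hsx hsy hρ measurable_fst hfst hA2 hB2
  have hκ : IsProbabilityMeasure (ν.map Prod.snd) :=
    Measure.isProbabilityMeasure_map (by fun_prop)
  rw [miE, hfst] at hc
  have h := integral_le_of_klDivE_eq (by fun_prop) hgi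
    (lintegral_exp_wynerLogDensity mx my hsx hsy hρ (ν.map Prod.snd) ha hb).le hc
  rw [hg] at h
  have h1 : 0 < 1 - |ρ| := by linarith
  have h2 : (∫ p, (U p - (a ∘ Prod.snd) p) ^ 2 ∂ν + ∫ p, (V p - (b ∘ Prod.snd) p) ^ 2 ∂ν) /
      (2 * (1 - |ρ|)) ≤ 1 := by
    rw [div_le_one (by positivity)]
    exact hle.trans_eq (by rw [i3])
  simp only [Function.comp_apply] at h2
  linarith

lemma miE_gaussianCoupling (mx my : ℝ) {sx sy ρ α β d : ℝ} (hsx : 0 < sx) (hsy : 0 < sy)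
    (hρ : |ρ| < 1) (hα : α ^ 2 = |ρ|) (hβ : β ^ 2 = |ρ|) (hαβ : α * β = ρ) (hd0 : 0 < d)
    (hd : d ^ 2 = 1 - |ρ|) :
    miE (gaussianCoupling mx my sx sy α β d) =
      ((1 / 2 * log ((1 + |ρ|) / (1 - |ρ|)) : ℝ) : EReal) := by
  have hfst := map_fst_gaussianCoupling mx my sx sy hρ hα hβ hαβ hd
  have hsnd := map_snd_gaussianCoupling mx my sx sy α β d
  have hw : MemLp (fun p : (ℝ × ℝ) × ℝ => p.2) 2 (gaussianCoupling mx my sx sy α β d) := by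
    have := memLp_id_gaussianReal_two
    rw [← hsnd] at this
    exact (memLp_map_measure_iff (by fun_prop) measurable_snd.aemeasurable).mp this
  obtain ⟨hgi, hg⟩ := integral_wynerLogDensity hsx hsy hρ measurable_fst hfst
    (hw.const_mul α) (hw.const_mul β)
  have h1 : ∫ p, ((p.1.1 - mx) / sx - α * p.2) ^ 2 ∂gaussianCoupling mx my sx sy α β d =
      d ^ 2 := by
    rw [gaussianCoupling, integral_map (by fun_prop) (by fun_prop)]
    have h : ∀ q : ℝ × ℝ × ℝ, ((mx + sx * (α * q.1) + sx * d * q.2.1 - mx) / sx - α * q.1) ^ 2 =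
        d ^ 2 * q.2.1 ^ 2 := fun q => by field_simp; ring
    simp_rw [h]
    rw [integral_const_mul, integral_fun_snd (fun q : ℝ × ℝ => q.1 ^ 2),
      integral_fun_fst (fun x : ℝ => x ^ 2), integral_sq_gaussianReal]
    simp
  have h2 : ∫ p, ((p.1.2 - my) / sy - β * p.2) ^ 2 ∂gaussianCoupling mx my sx sy α β d =
      d ^ 2 := by
    rw [gaussianCoupling, integral_map (by fun_prop) (by fun_prop)]
    have h : ∀ q : ℝ × ℝ × ℝ, ((my + sy * (β * q.1) + sy * d * q.2.2 - my) / sy - β * q.1) ^ 2 =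
        d ^ 2 * q.2.2 ^ 2 := fun q => by field_simp; ring
    simp_rw [h]
    rw [integral_const_mul, integral_fun_snd (fun q : ℝ × ℝ => q.2 ^ 2),
      integral_fun_snd (fun x : ℝ => x ^ 2), integral_sq_gaussianReal]
    simp
  rw [h1, h2] at hg
  rw [miE, hfst, hsnd]
  have hdens := gaussianCoupling_eq_withDensity mx my (α := α) (β := β) hsx hsy hρ hd0 hd
  rw [hdens] at hgi hg ⊢
  rw [klDivE_withDensity_exp (by fun_prop) hgi, hg, hd]
  congr 1
  have : (1 - |ρ| + (1 - |ρ|)) / (2 * (1 - |ρ|)) = 1 := by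
    rw [div_eq_one_iff_eq (by linarith)]; ring
  rw [this]; ring

/-- For jointly Gaussian scalar random variables `X, Y` with correlation
coefficient `ρ`, `|ρ| < 1`, Wyner's common information (the infimum of `I(X,Y;W)` over all `W`
jointly distributed with `(X,Y)` such that `X` and `Y` are conditionally independent given `W`)
equals `½ log((1+|ρ|)/(1−|ρ|))` (natural logarithm). -/
theorem wynerCI_gaussian_scalar
    {Ω : Type*} [MeasurableSpace Ω] (μ : Measure Ω) [IsProbabilityMeasure μ]
    (X Y : Ω → ℝ) (hX : Measurable X) (hY : Measurable Y)
    -- `X` and `Y` are jointly Gaussian: every linear combination is Gaussian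
    (hGauss : ∀ a b : ℝ, ∃ (m : ℝ) (v : ℝ≥0),
      μ.map (fun ω => a * X ω + b * Y ω) = gaussianReal m v)
    -- nondegenerate variances
    (hVarX : 0 < ∫ ω, (X ω - ∫ x, X x ∂μ) ^ 2 ∂μ)
    (hVarY : 0 < ∫ ω, (Y ω - ∫ x, Y x ∂μ) ^ 2 ∂μ)
    -- `ρ` is the correlation coefficient of `X` and `Y`
    (ρ : ℝ)
    (hρ : ρ = (∫ ω, (X ω - ∫ x, X x ∂μ) * (Y ω - ∫ x, Y x ∂μ) ∂μ) /
      Real.sqrt ((∫ ω, (X ω - ∫ x, X x ∂μ) ^ 2 ∂μ) * (∫ ω, (Y ω - ∫ x, Y x ∂μ) ^ 2 ∂μ)))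
    (hρ1 : |ρ| < 1) :
    sInf { c : ℝ |
      ∃ ν : Measure ((ℝ × ℝ) × ℝ), ∃ _ : IsProbabilityMeasure ν,
        -- `ν` is the joint law of `((X,Y), W)`; its `(X,Y)`-marginal is the law of `(X,Y)`
        ν.map Prod.fst = μ.map (fun ω => (X ω, Y ω)) ∧
        -- `X` and `Y` are conditionally independent given `W`
        CondIndepFun (MeasurableSpace.comap Prod.snd inferInstance)
          (MeasurableSpace.comap_le_iff_le_map.mpr measurable_snd.le_map)
          (fun p => p.1.1) (fun p => p.1.2) ν ∧
        -- `c = I(X,Y;W)`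
        miE ν = (c : EReal) } =
      1 / 2 * Real.log ((1 + |ρ|) / (1 - |ρ|)) := by
  have hsx := Real.sqrt_pos.mpr hVarX
  have hsy := Real.sqrt_pos.mpr hVarY
  have hlaw := map_prodMk_eq_gaussianPair hX hY hGauss (Real.sq_sqrt hVarX.le).symm
    (Real.sq_sqrt hVarY.le).symm (ρ := ρ)
    (by rw [mul_assoc, ← Real.sqrt_mul hVarX.le, hρ, div_mul_cancel₀]; positivity) hρ1
  rw [hlaw]
  obtain ⟨hd0, hd⟩ := sqrt_one_sub_abs_sq hρ1
  have hα : √|ρ| ^ 2 = |ρ| := Real.sq_sqrt (abs_nonneg ρ)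
  obtain ⟨β, hβ, hαβ⟩ : ∃ β, β ^ 2 = |ρ| ∧ √|ρ| * β = ρ := by
    rcases le_total 0 ρ with h | h
    · exact ⟨√|ρ|, hα, by rw [← sq, hα, abs_of_nonneg h]⟩
    · exact ⟨-√|ρ|, by rw [neg_sq, hα], by rw [mul_neg, ← sq, hα, abs_of_nonpos h, neg_neg]⟩
  refine IsLeast.csInf_eq ⟨⟨_, isProbabilityMeasure_gaussianCoupling _ _ _ _ √|ρ| β √(1 - |ρ|),
    map_fst_gaussianCoupling _ _ _ _ hρ1 hα hβ hαβ hd, ?_,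
    miE_gaussianCoupling _ _ hsx hsy hρ1 hα hβ hαβ hd0 hd⟩, ?_⟩
  · exact condIndepFun_map_prod
      (f := fun q => (∫ ω, X ω ∂μ + √(∫ ω, (X ω - ∫ x, X x ∂μ) ^ 2 ∂μ) * (√|ρ| * q.1)) +
        (√(∫ ω, (X ω - ∫ x, X x ∂μ) ^ 2 ∂μ) * √(1 - |ρ|)) * q.2)
      (g := fun q => (∫ ω, Y ω ∂μ + √(∫ ω, (Y ω - ∫ x, Y x ∂μ) ^ 2 ∂μ) * (β * q.1)) +
        (√(∫ ω, (Y ω - ∫ x, Y x ∂μ) ^ 2 ∂μ) * √(1 - |ρ|)) * q.2)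
      (by fun_prop) (by fun_prop) rfl
  · rintro c ⟨ν, _, hfst, hci, hc⟩
    exact le_of_condIndepFun_of_miE_eq hsx hsy hρ1 hfst hci hc
end

section
/- Let X̃₁ be uniform on {0,1}, let Ỹ₁ be the output of a binary symmetric channel with crossover probability a₀ ∈ (0, 1/2) applied to X̃₁, and let X̃₂ and Ỹ₂ be uniform on {0,1}, with X̃₂, Ỹ₂ and the pair (X̃₁,Ỹ₁) mutually independent. Define the random vectors X = (X̃₁ ⊕ X̃₂, X̃₂) and Y = (Ỹ₁ ⊕ Ỹ₂, Ỹ₂). Then the mutual information between the vectors X and Y equals the mutual information between X̃₁ and Ỹ₁, i.e., I(X;Y) = I(X̃₁;Ỹ₁), and moreover X and Y are conditionally independent given the pair (X̃₁, Ỹ₁). -/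
open scoped BigOperators
open Classical

noncomputable section

/-- `p` is a probability mass function on the finite alphabet `α`. -/
def IsPMF {α : Type*} [Fintype α] (p : α → ℝ) : Prop :=
  (∀ a, 0 ≤ p a) ∧ ∑ a, p a = 1

/-- Pushforward of a pmf under a map (distribution of `f(X)` when `X ~ p`). -/
noncomputable def pmfMap {α β : Type*} [Fintype α] (f : α → β) (p : α → ℝ) : β → ℝ :=
  fun b => ∑ a, if f a = b then p a else 0

/-- Shannon entropy (in nats) of a pmf on a finite alphabet. -/
noncomputable def Hent {α : Type*} [Fintype α] (p : α → ℝ) : ℝ :=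
  ∑ a, Real.negMulLog (p a)

/-- Mutual information `I(X;Y)` of a joint pmf `p` of the pair `(X,Y)`. -/
noncomputable def mi {α β : Type*} [Fintype α] [Fintype β] (p : α × β → ℝ) : ℝ :=
  Hent (pmfMap Prod.fst p) + Hent (pmfMap Prod.snd p) - Hent p

/-- Mutual information `I(X,Y;W)` of a joint pmf `q` of the triple `((X,Y),W)`. -/
noncomputable def miW {α β W : Type*} [Fintype α] [Fintype β] [Fintype W]
    (q : (α × β) × W → ℝ) : ℝ :=
  Hent (pmfMap Prod.fst q) + Hent (pmfMap Prod.snd q) - Hent q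

/-- Conditional mutual information `I(X;Y|W)` of a joint pmf `q` of `((X,Y),W)`,
written as `H(X,W) + H(Y,W) - H(W) - H(X,Y,W)`. -/
noncomputable def cmi {α β W : Type*} [Fintype α] [Fintype β] [Fintype W]
    (q : (α × β) × W → ℝ) : ℝ :=
  Hent (pmfMap (fun x => (x.1.1, x.2)) q) + Hent (pmfMap (fun x => (x.1.2, x.2)) q)
    - Hent (pmfMap Prod.snd q) - Hent q

/-- The set of values `I(X,Y;W)` over all finite-alphabet `W` jointly distributed with `(X,Y)`
(i.e. over all conditional distributions `p(w|x,y)`) such that `I(X;Y|W) ≤ γ`. -/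
def relaxedSet {α β : Type*} [Fintype α] [Fintype β] (p : α × β → ℝ) (γ : ℝ) : Set ℝ :=
  { c | ∃ (m : ℕ) (q : (α × β) × Fin m → ℝ), IsPMF q ∧
      (pmfMap Prod.fst q = p) ∧ cmi q ≤ γ ∧ c = miW q }

/-- Relaxed Wyner's common information `C_γ(X;Y)` of a joint pmf `p` of `(X,Y)`. -/
noncomputable def Cgamma {α β : Type*} [Fintype α] [Fintype β] (p : α × β → ℝ) (γ : ℝ) : ℝ :=
  sInf (relaxedSet p γ)

/-- Wyner's common information `C(X;Y)`: infimum of `I(X,Y;W)` over all finite-alphabet `W`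
rendering `X` and `Y` conditionally independent, i.e. `I(X;Y|W) = 0`. -/
noncomputable def WynerCI {α β : Type*} [Fintype α] [Fintype β] (p : α × β → ℝ) : ℝ :=
  sInf { c | ∃ (m : ℕ) (q : (α × β) × Fin m → ℝ), IsPMF q ∧
      (pmfMap Prod.fst q = p) ∧ cmi q = 0 ∧ c = miW q }

end
/-- The law of `g (f ω)` is the pushforward under `g` of the law of `f ω`. -/
lemma pmfMap_pmfMap {α β γ : Type*} [Fintype α] [Fintype β] (g : β → γ) (f : α → β)
    (p : α → ℝ) : pmfMap g (pmfMap f p) = pmfMap (fun a => g (f a)) p := by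
  funext c
  simp only [pmfMap, ← Finset.sum_filter]
  rw [Finset.sum_comm' (t' := Finset.univ.filter fun a => g (f a) = c)
    (s' := fun a => {f a}) (by grind)]
  simp

/-- Entropy is invariant under injective relabelling of the alphabet. -/
lemma Hent_pmfMap_of_injective {α β : Type*} [Fintype α] [Fintype β] {f : α → β}
    (hf : Function.Injective f) (p : α → ℝ) : Hent (pmfMap f p) = Hent p := by
  have hval (a : α) : pmfMap f p (f a) = p a := by simp [pmfMap, hf.eq_iff]
  unfold Hent
  rw [← Finset.sum_subset (Finset.subset_univ (Finset.univ.image f)),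
    Finset.sum_image hf.injOn]
  · simp only [hval]
  · intro b _ hb
    have h0 : pmfMap f p b = 0 :=
      Finset.sum_eq_zero fun a _ => if_neg fun h => hb (by simp [← h])
    simp [h0]

/-- Entropy of the law of `h (f ω)` for injective `h`. -/
lemma Hent_pmfMap_comp_of_injective {α β γ : Type*} [Fintype α] [Fintype β] [Fintype γ]
    {h : β → γ} (hh : Function.Injective h) (f : α → β) (p : α → ℝ) :
    Hent (pmfMap (fun a => h (f a)) p) = Hent (pmfMap f p) := by
  rw [← pmfMap_pmfMap, Hent_pmfMap_of_injective hh]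

/-- Effect on one entropy term of halving an atom, as an independent uniform bit does. -/
lemma negMulLog_div_two (x : ℝ) :
    Real.negMulLog (x / 2) = Real.negMulLog x / 2 + x / 2 * Real.log 2 := by
  rw [div_eq_mul_inv, Real.negMulLog_mul]
  simp only [Real.negMulLog, Real.log_inv]
  ring

/-- `(u, v) ↦ (u ⊕ v, v)` is injective. -/
lemma injective_xor : Function.Injective fun t : Bool × Bool => (Bool.xor t.1 t.2, t.2) := by
  rintro ⟨_, _⟩ ⟨_, _⟩ h
  simp only [Prod.mk.injEq] at h ⊢
  obtain ⟨h, rfl⟩ := h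
  simpa using h

lemma injective_xor_fst_pair : Function.Injective fun t : Bool × Bool × Bool =>
    ((Bool.xor t.1 t.2.2, t.2.2), (t.1, t.2.1)) := by
  rintro ⟨_, _, _⟩ ⟨_, _, _⟩ h
  simp_all

lemma injective_xor_snd_pair : Function.Injective fun t : Bool × Bool × Bool =>
    ((Bool.xor t.2.1 t.2.2, t.2.2), (t.1, t.2.1)) := by
  rintro ⟨_, _, _⟩ ⟨_, _, _⟩ h
  simp_all

lemma injective_xor_xor : Function.Injective fun ω : Bool × Bool × Bool × Bool =>
    ((Bool.xor ω.1 ω.2.2.1, ω.2.2.1), (Bool.xor ω.2.1 ω.2.2.2, ω.2.2.2)) := by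
  rintro ⟨_, _, _, _⟩ ⟨_, _, _, _⟩ h
  simp only [Prod.mk.injEq] at h ⊢
  obtain ⟨⟨h₁, rfl⟩, h₂, rfl⟩ := h
  simpa using And.intro h₁ h₂

lemma injective_xor_xor_pair : Function.Injective fun ω : Bool × Bool × Bool × Bool =>
    (((Bool.xor ω.1 ω.2.2.1, ω.2.2.1), (Bool.xor ω.2.1 ω.2.2.2, ω.2.2.2)), (ω.1, ω.2.1)) :=
  fun _ _ h => injective_xor_xor (congrArg Prod.fst h)

/-- With `X̃₁` uniform, `Ỹ₁` the output of a BSC(`a₀`) applied to `X̃₁`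
(`a₀ ∈ (0,1/2)`), and `X̃₂, Ỹ₂` uniform bits such that `X̃₂`, `Ỹ₂`, `(X̃₁,Ỹ₁)` are mutually
independent, set `X = (X̃₁⊕X̃₂, X̃₂)` and `Y = (Ỹ₁⊕Ỹ₂, Ỹ₂)`. Then
`I(X;Y) = I(X̃₁;Ỹ₁)`, and `X` and `Y` are conditionally independent given `(X̃₁,Ỹ₁)`,
i.e. `I(X;Y | (X̃₁,Ỹ₁)) = 0`. -/
theorem binary_example_mutual_information_and_cond_indep
    (a₀ : ℝ) (ha₀ : 0 < a₀) (ha₁ : a₀ < 1 / 2)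
    (p : Bool × Bool × Bool × Bool → ℝ)
    (hp : p = fun ω => (if ω.1 = ω.2.1 then (1 - a₀) / 2 else a₀ / 2) * (1 / 2) * (1 / 2))
    (X Y : Bool × Bool × Bool × Bool → Bool × Bool)
    (hX : X = fun ω => (Bool.xor ω.1 ω.2.2.1, ω.2.2.1))
    (hY : Y = fun ω => (Bool.xor ω.2.1 ω.2.2.2, ω.2.2.2)) :
    mi (pmfMap (fun ω => (X ω, Y ω)) p) = mi (pmfMap (fun ω => (ω.1, ω.2.1)) p) ∧
      cmi (pmfMap (fun ω => ((X ω, Y ω), (ω.1, ω.2.1))) p) = 0 := by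
  subst hX hY
  have hXY := Hent_pmfMap_of_injective injective_xor_xor p
  have hXYW := Hent_pmfMap_of_injective injective_xor_xor_pair p
  have hXW := Hent_pmfMap_comp_of_injective injective_xor_fst_pair
    (fun ω : Bool × Bool × Bool × Bool => (ω.1, ω.2.1, ω.2.2.1)) p
  have hYW := Hent_pmfMap_comp_of_injective injective_xor_snd_pair
    (fun ω : Bool × Bool × Bool × Bool => (ω.1, ω.2.1, ω.2.2.2)) p
  have hX := Hent_pmfMap_comp_of_injective injective_xor
    (fun ω : Bool × Bool × Bool × Bool => (ω.1, ω.2.2.1)) p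
  have hY := Hent_pmfMap_comp_of_injective injective_xor
    (fun ω : Bool × Bool × Bool × Bool => (ω.2.1, ω.2.2.2)) p
  dsimp only at hXW hYW hX hY
  have hp1 : pmfMap (fun ω => ω.1) p = fun _ => 1 / 2 := by
    funext x
    cases x <;> simp [hp, pmfMap, Fintype.sum_prod_type] <;> ring
  have hp2 : pmfMap (fun ω => ω.2.1) p = fun _ => 1 / 2 := by
    funext x
    cases x <;> simp [hp, pmfMap, Fintype.sum_prod_type] <;> ring
  have hp13 : pmfMap (fun ω => (ω.1, ω.2.2.1)) p = fun _ => 1 / 2 / 2 := by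
    funext ⟨x, y⟩
    cases x <;> cases y <;> simp [hp, pmfMap, Fintype.sum_prod_type] <;> ring
  have hp24 : pmfMap (fun ω => (ω.2.1, ω.2.2.2)) p = fun _ => 1 / 2 / 2 := by
    funext ⟨x, y⟩
    cases x <;> cases y <;> simp [hp, pmfMap, Fintype.sum_prod_type] <;> ring
  have hp12 : pmfMap (fun ω => (ω.1, ω.2.1)) p
      = fun t => if t.1 = t.2 then (1 - a₀) / 2 else a₀ / 2 := by
    funext ⟨x, y⟩
    cases x <;> cases y <;> simp [hp, pmfMap, Fintype.sum_prod_type] <;> ring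
  have hp123 : pmfMap (fun ω => (ω.1, ω.2.1, ω.2.2.1)) p
      = fun t => (if t.1 = t.2.1 then (1 - a₀) / 2 else a₀ / 2) / 2 := by
    funext ⟨x, y, z⟩
    cases x <;> cases y <;> cases z <;> simp [hp, pmfMap, Fintype.sum_prod_type] <;> ring
  have hp124 : pmfMap (fun ω => (ω.1, ω.2.1, ω.2.2.2)) p
      = fun t => (if t.1 = t.2.1 then (1 - a₀) / 2 else a₀ / 2) / 2 := by
    funext ⟨x, y, z⟩
    cases x <;> cases y <;> cases z <;> simp [hp, pmfMap, Fintype.sum_prod_type] <;> ring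
  have hp_div : p = fun ω => (if ω.1 = ω.2.1 then (1 - a₀) / 2 else a₀ / 2) / 2 / 2 := by
    rw [hp]
    funext ω
    ring
  simp only [mi, cmi, pmfMap_pmfMap]
  rw [hX, hY, hXY, hXW, hYW, hXYW, hp1, hp2, hp12, hp13, hp24, hp123, hp124, hp_div]
  constructor <;>
  · simp only [Hent, negMulLog_div_two, Fintype.sum_prod_type, Fintype.sum_bool, if_true,
      reduceCtorEq, if_false]
    ring
end
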